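/- Define d(x₀) = x₀⁻¹·[max(0, L(x₀)) - min(L(x₀), e⁻¹·sign(e⁻¹ - x₀))] for x₀ > 0, where L(x) = x log x. Then d attains its minimum over (0, ∞) at x₀ = 1, with d(1) = e⁻¹. -/

import Mathlib

theorem optimal_interval_scaling :
    (fun x₀ : ℝ => x₀⁻¹ * (max 0 (x₀ * Real.log x₀) -
        min (x₀ * Real.log x₀) (Real.exp (-1) * Real.sign (Real.exp (-1) - x₀)))) 1 =
      Real.exp (-1) ∧
    ∀ x₀ : ℝ, 0 < x₀ →
      Real.exp (-1) ≤ x₀⁻¹ * (max 0 (x₀ * Real.log x₀) -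
        min (x₀ * Real.log x₀) (Real.exp (-1) * Real.sign (Real.exp (-1) - x₀))) := by
  have hpos : 0 < Real.exp (-1) := Real.exp_pos _
  have hlt : Real.exp (-1) < 1 := by
    rw [Real.exp_lt_one_iff]; norm_num
  constructor
  · have hs : Real.sign (Real.exp (-1) - 1) = -1 := Real.sign_of_neg (by linarith)
    simp only [hs, Real.log_one, mul_zero, max_self, inv_one, one_mul]
    rw [min_eq_right (by linarith)]
    ring
  · intro x hx
    rw [inv_mul_eq_div, le_div_iff₀ hx]
    have h0 := le_max_left 0 (x * Real.log x)
    have h1 := le_max_right 0 (x * Real.log x)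
    rcases le_or_gt x (Real.exp (-1)) with h | h
    · have hm := min_le_left (x * Real.log x)
        (Real.exp (-1) * Real.sign (Real.exp (-1) - x))
      have hl : Real.log x ≤ -1 := (Real.log_le_iff_le_exp hx).2 h
      nlinarith
    · have hm := min_le_right (x * Real.log x)
        (Real.exp (-1) * Real.sign (Real.exp (-1) - x))
      have hs : Real.sign (Real.exp (-1) - x) = -1 := Real.sign_of_neg (by linarith)
      rw [hs] at hm ⊢
      rcases le_or_gt x 1 with h2 | h2
      · nlinarith
      · have hl := Real.one_sub_inv_le_log_of_pos hx
        have hL : x - 1 ≤ x * Real.log x := by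
          have := mul_le_mul_of_nonneg_left hl hx.le
          rwa [mul_sub, mul_inv_cancel₀ hx.ne', mul_one] at this
        nlinarith
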